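/- Let U be a finite index subgroup of F₂ satisfying Property B. Then for every n ∈ ℕ ∪ {0}: Stab(Hₙ) = {γ ∈ Aut⁺(F₂) : γ(U) = U and for every j with 2 ≤ j ≤ k, α(γ(gⱼ)) ≡ 0 (mod n)} (for n = 0 the congruence condition means α(γ(gⱼ)) = 0). -/

import Mathlib

/-- The free group on two generators. -/
abbrev F2 := FreeGroup (Fin 2)

/-- The generator `x` of `F₂`. -/
def xg : F2 := FreeGroup.of 0

/-- The generator `y` of `F₂`. -/
def yg : F2 := FreeGroup.of 1

/-- The exponent sum of the `i`-th generator, i.e. the `i`-th coordinate of the image in the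
abelianization `ℤ²` of `F₂`. -/
def expSum (i : Fin 2) : F2 →* Multiplicative ℤ :=
  FreeGroup.lift fun j => Multiplicative.ofAdd (if j = i then (1 : ℤ) else 0)

/-- The matrix in `GL₂(ℤ)` induced by an automorphism `γ` of `F₂` on the abelianization
`F₂^ab ≅ ℤ²` (with basis the images of `x` and `y`); i.e. `β̂(γ)`. -/
def autMat (γ : F2 ≃* F2) : Matrix (Fin 2) (Fin 2) ℤ :=
  Matrix.of fun i j => Multiplicative.toAdd (expSum i (γ (FreeGroup.of j)))

abbrev SL2Z := Matrix.SpecialLinearGroup (Fin 2) ℤ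

/-- `Stab(V) = {γ ∈ Aut⁺(F₂) : γ(V) = V}`. -/
def StabSet (V : Subgroup F2) : Set (F2 ≃* F2) :=
  { γ | (autMat γ).det = 1 ∧ Subgroup.map γ.toMonoidHom V = V }

/-- The Veech group `Γ(V) = β̂(Stab(V)) ⊆ SL₂(ℤ)` of a subgroup `V` of `F₂`. -/
def VeechGroup (V : Subgroup F2) : Set SL2Z :=
  { A | ∃ γ : F2 ≃* F2, γ ∈ StabSet V ∧ (A : Matrix (Fin 2) (Fin 2) ℤ) = autMat γ }

/-- A set of elements of `SL₂(ℤ)` is a congruence group if it contains the principal congruence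
subgroup `Γ(n)` for some `n ≥ 1`. -/
def IsCongruenceSet (S : Set SL2Z) : Prop :=
  ∃ n : ℕ, 1 ≤ n ∧ (CongruenceSubgroup.Gamma n : Set SL2Z) ⊆ S

/-- The subgroup of `Multiplicative ℤ` of elements divisible by `n`. -/
def divSub (n : ℤ) : Subgroup (Multiplicative ℤ) where
  carrier := {d | n ∣ Multiplicative.toAdd d}
  one_mem' := dvd_zero n
  mul_mem' := fun ha hb => dvd_add ha hb
  inv_mem' := fun ha => dvd_neg.mpr ha

/-- The subgroup `Hₙ = {u ∈ U : n ∣ α(u)}` of `F₂` (for `n = 0` this is `ker α = H₀`). -/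
def Hgrp {U : Subgroup F2} (α : U →* Multiplicative ℤ) (n : ℕ) : Subgroup F2 :=
  Subgroup.map U.subtype (Subgroup.comap α (divSub (n : ℤ)))

/-- The subgroup `U_L` of `F₂` corresponding to the origami `L(2,3)`. -/
def UL : Subgroup F2 :=
  Subgroup.closure {xg ^ 3, xg * yg * xg⁻¹, xg ^ 2 * yg * (xg ^ 2)⁻¹, yg * xg * yg⁻¹, yg ^ 2}

/-- The subgroup `U_D` of `F₂` corresponding to the origami `D`. -/
def UD : Subgroup F2 :=
  Subgroup.closure {xg ^ 3, xg * yg * (xg ^ 2)⁻¹, xg ^ 2 * yg * xg⁻¹, yg * xg * yg⁻¹,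
    yg ^ 2 * xg * (yg ^ 2)⁻¹, yg ^ 3}

theorem mem_Hgrp {U : Subgroup F2} {α : U →* Multiplicative ℤ} {n : ℕ} {x : F2} :
    x ∈ Hgrp α n ↔ ∃ h : x ∈ U, (n : ℤ) ∣ Multiplicative.toAdd (α ⟨x, h⟩) := by
  constructor
  · rintro ⟨⟨y, hy⟩, h, rfl⟩
    exact ⟨hy, h⟩
  · rintro ⟨hx, h⟩
    exact ⟨⟨x, hx⟩, h, rfl⟩

theorem Hgrp_le {U : Subgroup F2} (α : U →* Multiplicative ℤ) (n : ℕ) : Hgrp α n ≤ U :=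
  fun _ hx => (mem_Hgrp.1 hx).1

theorem Hgrp_zero_le {U : Subgroup F2} (α : U →* Multiplicative ℤ) (n : ℕ) :
    Hgrp α 0 ≤ Hgrp α n := fun _ hx =>
  let ⟨h, h0⟩ := mem_Hgrp.1 hx
  mem_Hgrp.2 ⟨h, (dvd_zero (n : ℤ)).trans (by simpa using h0)⟩

theorem conj_mem_Hgrp {U : Subgroup F2} {α : U →* Multiplicative ℤ} {n : ℕ} {u x : F2}
    (hu : u ∈ U) (hx : x ∈ Hgrp α n) : u * x * u⁻¹ ∈ Hgrp α n := by
  obtain ⟨hxU, hd⟩ := mem_Hgrp.1 hx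
  refine mem_Hgrp.2 ⟨U.mul_mem (U.mul_mem hu hxU) (U.inv_mem hu), ?_⟩
  have : (⟨u * x * u⁻¹, U.mul_mem (U.mul_mem hu hxU) (U.inv_mem hu)⟩ : U) =
      ⟨u, hu⟩ * ⟨x, hxU⟩ * ⟨u, hu⟩⁻¹ := rfl
  have hα : α (⟨u, hu⟩ * ⟨x, hxU⟩ * ⟨u, hu⟩⁻¹) = α ⟨x, hxU⟩ := by
    rw [map_mul α, map_mul α, map_inv α, mul_inv_cancel_comm]
  rwa [this, hα]

/-- Under Property B the normalizer of `Hₙ` in `F₂` is `U`. -/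
theorem normalizer_Hgrp {U : Subgroup F2} {α : U →* Multiplicative ℤ}
    (hB : ∀ w : F2, w ∉ U → ¬ ∀ h ∈ Hgrp α 0, w * h * w⁻¹ ∈ U) (n : ℕ) :
    Subgroup.normalizer (Hgrp α n : Set F2) = U := by
  ext w
  rw [Subgroup.mem_normalizer_iff]
  constructor
  · intro hw
    by_contra hwU
    exact hB w hwU fun h hh => Hgrp_le α n ((hw h).1 (Hgrp_zero_le α n hh))
  · intro hw x
    refine ⟨conj_mem_Hgrp hw, fun hx => ?_⟩
    simpa [mul_assoc] using conj_mem_Hgrp (U.inv_mem hw) hx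

/-- A homomorphism `φ : U → ℤ` whose values on all generators other than `s i₀` are divisible by
`n` is, modulo `n`, a multiple of the homomorphism `α` with `α (s i₀) = 1` that vanishes on the
other generators. -/
theorem dvd_toAdd_sub_mul_toAdd {G ι : Type*} [Group G] {s : ι → G}
    (hs : Subgroup.closure (Set.range s) = ⊤) (i₀ : ι) {α φ : G →* Multiplicative ℤ} {n : ℤ}
    (h₀ : α (s i₀) = Multiplicative.ofAdd 1) (hα : ∀ i, i ≠ i₀ → α (s i) = 1)
    (hφ : ∀ i, i ≠ i₀ → n ∣ Multiplicative.toAdd (φ (s i))) (u : G) :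
    n ∣ Multiplicative.toAdd (φ u) -
      Multiplicative.toAdd (φ (s i₀)) * Multiplicative.toAdd (α u) := by
  have hu : u ∈ Subgroup.closure (Set.range s) := hs ▸ Subgroup.mem_top u
  induction hu using Subgroup.closure_induction with
  | mem x hx =>
    obtain ⟨i, rfl⟩ := hx
    by_cases hi : i = i₀
    · simp [hi, h₀]
    · simpa [hα i hi] using hφ i hi
  | one => simp
  | mul x y _ _ hx hy =>
    rw [map_mul φ, map_mul α, toAdd_mul, toAdd_mul, mul_add, add_sub_add_comm]
    exact Int.dvd_add hx hy
  | inv x _ hx =>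
    rw [map_inv φ, map_inv α, toAdd_inv, toAdd_inv, mul_neg, ← neg_sub']
    exact Int.dvd_neg.2 hx

/-- Setting A with Property B: `Stab(Hₙ)` consists exactly of those `γ ∈ Aut⁺(F₂)` with
`γ(U) = U` and `α(γ(gⱼ)) ≡ 0 (mod n)` for all `j ≥ 2` (for `n = 0` the congruence means
`α(γ(gⱼ)) = 0`). -/
theorem stab_Hn_characterization
    (k : ℕ) (hk : 2 ≤ k) (U : Subgroup F2) (hfin : U.FiniteIndex)
    (g : Fin k → F2)
    -- `g` is a free basis of `U`:
    (hgen : Subgroup.closure (Set.range g) = U)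
    (hfree : Function.Injective ⇑(FreeGroup.lift g : FreeGroup (Fin k) →* F2))
    (hgU : ∀ j, g j ∈ U)
    -- `α : U → ℤ` is the homomorphism with `α(g₁) = 1` and `α(gⱼ) = 0` for `j ≥ 2`:
    (α : U →* Multiplicative ℤ)
    (hα0 : α ⟨g ⟨0, by omega⟩, hgU _⟩ = Multiplicative.ofAdd 1)
    (hαj : ∀ j : Fin k, j ≠ ⟨0, by omega⟩ → α ⟨g j, hgU j⟩ = 1)
    -- Property B:
    (hB : ∀ w : F2, w ∉ U → ¬ ∀ h ∈ Hgrp α 0, w * h * w⁻¹ ∈ U)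
    : ∀ n : ℕ, ∀ γ : F2 ≃* F2,
      γ ∈ StabSet (Hgrp α n) ↔
        ((autMat γ).det = 1 ∧ Subgroup.map γ.toMonoidHom U = U ∧
          ∀ j : Fin k, j ≠ ⟨0, by omega⟩ → ∀ hm : γ (g j) ∈ U,
            (n : ℤ) ∣ Multiplicative.toAdd (α ⟨γ (g j), hm⟩)) := by
  intro n γ
  constructor
  · rintro ⟨hdet, hmap⟩
    refine ⟨hdet, ?_, fun j hj hm => ?_⟩
    · have hnorm := Subgroup.map_equiv_normalizer_eq (Hgrp α n) γ
      rwa [hmap, normalizer_Hgrp hB n] at hnorm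
    · have hg : g j ∈ Hgrp α n := mem_Hgrp.2 ⟨hgU j, by simp [hαj j hj]⟩
      exact (mem_Hgrp.1 (hmap.le (Subgroup.mem_map_of_mem γ.toMonoidHom hg))).2
  · rintro ⟨hdet, hmap, hdvd⟩
    refine ⟨hdet, ?_⟩
    have hγ (u : F2) (hu : u ∈ U) : γ u ∈ U :=
      hmap.le (Subgroup.mem_map_of_mem γ.toMonoidHom hu)
    have hsurj (v : F2) (hv : v ∈ U) : ∃ u ∈ U, γ u = v := hmap.ge hv
    let s : Fin k → U := fun j => ⟨g j, hgU j⟩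
    have hs : Subgroup.closure (Set.range s) = ⊤ := by
      apply Subgroup.map_injective U.subtype_injective
      rw [MonoidHom.map_closure, ← Set.range_comp, ← MonoidHom.range_eq_map, Subgroup.range_subtype]
      exact hgen
    let φ : U →* Multiplicative ℤ :=
      α.comp ((γ.toMonoidHom.comp U.subtype).codRestrict U fun u => hγ u u.2)
    have key := dvd_toAdd_sub_mul_toAdd hs ⟨0, by omega⟩ (φ := φ) (n := n) hα0 hαj
      fun j hj => hdvd j hj _
    set c := Multiplicative.toAdd (φ (s ⟨0, by omega⟩))
    obtain ⟨e, he, hge⟩ := hsurj _ (hgU ⟨0, by omega⟩)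
    have hφe : φ ⟨e, he⟩ = Multiplicative.ofAdd 1 := by
      rw [← hα0]
      exact congrArg α (Subtype.ext hge)
    have hc : IsCoprime (n : ℤ) c := by
      obtain ⟨q, hq⟩ := key ⟨e, he⟩
      rw [hφe, toAdd_ofAdd] at hq
      exact ⟨q, Multiplicative.toAdd (α ⟨e, he⟩), by linarith⟩
    have hiff (u : F2) (hu : u ∈ U) : γ u ∈ Hgrp α n ↔ u ∈ Hgrp α n := by
      have hφu : γ u ∈ Hgrp α n ↔ (n : ℤ) ∣ Multiplicative.toAdd (φ ⟨u, hu⟩) :=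
        mem_Hgrp.trans ⟨fun h => h.2, fun h => ⟨hγ u hu, h⟩⟩
      rw [hφu, mem_Hgrp, exists_prop_of_true hu,
        dvd_iff_dvd_of_dvd_sub (key ⟨u, hu⟩)]
      exact ⟨hc.dvd_of_dvd_mul_left, fun h => h.mul_left c⟩
    ext v
    constructor
    · rintro ⟨u, hu, rfl⟩
      exact (hiff u (Hgrp_le α n hu)).2 hu
    · intro hv
      obtain ⟨u, hu, rfl⟩ := hsurj v (Hgrp_le α n hv)
      exact ⟨u, (hiff u hu).1 hv, rfl⟩
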